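/- Let 𝒜 = {L_1, …, L_n} be n ≥ 1 pairwise distinct affine lines in ℂ², let R be a commutative ring, let C ⊆ {1, …, n} be a parallel class of 𝒜 with #C = r, and choose a bijection u : C → {1, …, r}. Let Ψ : Λ(R^n) → Λ(R^{r+1}) be the R-algebra homomorphism induced (by functoriality of the exterior algebra) by the R-linear map R^n → R^{r+1} sending e_i to ẽ_{u(i)} if i ∈ C and to ẽ_{r+1} if i ∉ C. Then Ψ maps the Orlik–Solomon ideal I_R(𝒜) into the ideal I_P(r); consequently Ψ descends to an R-algebra homomorphism Δ_dir : A_R(𝒜) → A_R(P_r), the directional degeneration homomorphism with respect to the parallel class C. -/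

import Mathlib

noncomputable section
open scoped Classical

/-- `L` is an (affine) line in `ℂ²`: a nonempty affine subspace whose direction
has dimension one. -/
def IsLine (L : AffineSubspace ℂ (ℂ × ℂ)) : Prop :=
  (L : Set (ℂ × ℂ)).Nonempty ∧ Module.finrank ℂ L.direction = 1

/-- Indices `i`, `j` are parallel: `i = j` or the lines do not meet. -/
def Par {n : ℕ} (L : Fin n → AffineSubspace ℂ (ℂ × ℂ)) (i j : Fin n) : Prop :=
  i = j ∨ (L i : Set (ℂ × ℂ)) ∩ (L j : Set (ℂ × ℂ)) = ∅

/-- The image `e_i` of the `i`-th standard basis vector of `R^n` in `Λ(R^n)`. -/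
def gen (R : Type*) [CommRing R] (n : ℕ) (i : Fin n) :
    ExteriorAlgebra R (Fin n → R) :=
  ExteriorAlgebra.ι R (Pi.single i 1)

/-- Generators of the Orlik-Solomon ideal of the line arrangement `L`. -/
def osGens (R : Type*) [CommRing R] {n : ℕ}
    (L : Fin n → AffineSubspace ℂ (ℂ × ℂ)) :
    Set (ExteriorAlgebra R (Fin n → R)) :=
  {x | ∃ i j : Fin n, i ≠ j ∧ (L i : Set (ℂ × ℂ)) ∩ (L j : Set (ℂ × ℂ)) = ∅ ∧
        x = gen R n i * gen R n j} ∪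
  {x | ∃ i j k : Fin n, i ≠ j ∧ i ≠ k ∧ j ≠ k ∧
        ((L i : Set (ℂ × ℂ)) ∩ (L j : Set (ℂ × ℂ)) ∩ (L k : Set (ℂ × ℂ))).Nonempty ∧
        x = gen R n i * gen R n j - gen R n i * gen R n k + gen R n j * gen R n k}

/-- The Orlik-Solomon ideal `I_R(𝒜)`: the two-sided ideal generated by `osGens`. -/
def osIdeal (R : Type*) [CommRing R] {n : ℕ}
    (L : Fin n → AffineSubspace ℂ (ℂ × ℂ)) :
    TwoSidedIdeal (ExteriorAlgebra R (Fin n → R)) :=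
  TwoSidedIdeal.span (osGens R L)

/-- The parallel class of the index `i`, as a finset of indices. -/
def parClass {n : ℕ} (L : Fin n → AffineSubspace ℂ (ℂ × ℂ)) (i : Fin n) :
    Finset (Fin n) :=
  Finset.univ.filter (fun j => Par L i j)

/-- Generators of the Orlik-Solomon ideal of the almost parallel arrangement `P_r`
of `r` parallel lines (the first `r` indices) together with one transversal line
(the last index) in `ℂ²`. -/
def parallelGens (R : Type*) [CommRing R] (r : ℕ) :
    Set (ExteriorAlgebra R (Fin (r + 1) → R)) :=
  {x | ∃ u v : Fin (r + 1), u < v ∧ (v : ℕ) < r ∧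
        x = gen R (r + 1) u * gen R (r + 1) v}

/-- The Orlik-Solomon ideal `I_P(r)` of the almost parallel arrangement `P_r`. -/
def parallelIdeal (R : Type*) [CommRing R] (r : ℕ) :
    TwoSidedIdeal (ExteriorAlgebra R (Fin (r + 1) → R)) :=
  TwoSidedIdeal.span (parallelGens R r)

/-- Two lines in `ℂ²` that do not meet have the same direction. -/
theorem IsLine.direction_eq_of_inter_eq_empty {L M : AffineSubspace ℂ (ℂ × ℂ)}
    (hL : IsLine L) (hM : IsLine M) (h : (L : Set (ℂ × ℂ)) ∩ (M : Set (ℂ × ℂ)) = ∅) :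
    L.direction = M.direction := by
  by_contra hne
  have hlt : L.direction ⊓ M.direction < L.direction := by
    refine lt_of_le_of_ne inf_le_left fun hinf => hne ?_
    exact Submodule.eq_of_le_of_finrank_eq (inf_eq_left.mp hinf) (hL.2.trans hM.2.symm)
  have hinf := Submodule.finrank_lt_finrank_of_lt hlt
  have hsum := Submodule.finrank_sup_add_finrank_inf_eq L.direction M.direction
  have hdim : Module.finrank ℂ (ℂ × ℂ) = 2 := by simp
  have hL1 := hL.2
  have hM1 := hM.2
  have htop : L.direction ⊔ M.direction = ⊤ :=
    Submodule.eq_top_of_finrank_eq (by omega)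
  exact (AffineSubspace.inter_nonempty_of_nonempty_of_sup_direction_eq_top hL.1 hM.1 htop).ne_empty h

/-- For distinct lines, being parallel means having the same direction. -/
theorem par_iff_direction_eq {n : ℕ} {L : Fin n → AffineSubspace ℂ (ℂ × ℂ)}
    (hline : ∀ i, IsLine (L i)) (hdist : Function.Injective L) (i j : Fin n) :
    Par L i j ↔ (L i).direction = (L j).direction := by
  constructor
  · rintro (rfl | h)
    · rfl
    · exact (hline i).direction_eq_of_inter_eq_empty (hline j) h
  · intro h
    rw [Par, or_iff_not_imp_right, ← Ne, ← Set.nonempty_iff_ne_empty]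
    exact fun hne => hdist (AffineSubspace.ext_of_direction_eq h hne)

theorem gen_mul_self (R : Type*) [CommRing R] (n : ℕ) (i : Fin n) :
    gen R n i * gen R n i = 0 :=
  ExteriorAlgebra.ι_sq_zero _

theorem gen_mul_gen_add_swap (R : Type*) [CommRing R] (n : ℕ) (i j : Fin n) :
    gen R n i * gen R n j + gen R n j * gen R n i = 0 :=
  ExteriorAlgebra.ι_add_mul_swap _ _

/-- The product of two generators attached to parallel lines of `P_r` lies in `I_P(r)`. -/
theorem gen_mul_gen_mem_parallelIdeal (R : Type*) [CommRing R] {r : ℕ} {a b : Fin (r + 1)}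
    (ha : (a : ℕ) < r) (hb : (b : ℕ) < r) :
    gen R (r + 1) a * gen R (r + 1) b ∈ parallelIdeal R r := by
  rcases lt_trichotomy a b with h | rfl | h
  · exact TwoSidedIdeal.subset_span ⟨a, b, h, hb, rfl⟩
  · rw [gen_mul_self]
    exact zero_mem _
  · rw [eq_neg_of_add_eq_zero_left (gen_mul_gen_add_swap R (r + 1) a b)]
    exact neg_mem (TwoSidedIdeal.subset_span ⟨b, a, h, ha, rfl⟩)

/-- Theorem 3.2 of the paper, directional degeneration. Let `C` be
the parallel class of `i₀` in `𝒜`, with `#C = r`, and let `u : {1,…,n} → {1,…,r+1}`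
send `C` bijectively to `{1,…,r}` and everything else to `r + 1`. Let
`Φ = Λ(f) : Λ(R^n) → Λ(R^{r+1})` be induced by the linear map `f` with
`f(e_i) = ẽ_{u(i)}`. Then `Φ(I_R(𝒜)) ⊆ I_P(r)`, and `Φ` descends to an `R`-algebra
homomorphism `Δ_dir : A_R(𝒜) → A_R(P_r)`. -/
theorem directional_degeneration
    {n : ℕ} (hn : 1 ≤ n) (L : Fin n → AffineSubspace ℂ (ℂ × ℂ))
    (hline : ∀ i, IsLine (L i)) (hdist : Function.Injective L)
    (R : Type*) [CommRing R] (i₀ : Fin n) {r : ℕ}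
    (hr : (parClass L i₀).card = r)
    (u : Fin n → Fin (r + 1))
    (hu1 : ∀ i ∈ parClass L i₀, (u i : ℕ) < r)
    (hu2 : ∀ i ∉ parClass L i₀, u i = Fin.last r)
    (hu3 : ∀ i ∈ parClass L i₀, ∀ j ∈ parClass L i₀, u i = u j → i = j)
    (f : (Fin n → R) →ₗ[R] (Fin (r + 1) → R))
    (hf : ∀ i : Fin n, f (Pi.single i 1) = Pi.single (u i) 1) :
    (∀ x ∈ osIdeal R L, ExteriorAlgebra.map f x ∈ parallelIdeal R r) ∧
    ∃ Δ : (osIdeal R L).ringCon.Quotient →ₐ[R] (parallelIdeal R r).ringCon.Quotient,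
      (∀ x : ExteriorAlgebra R (Fin n → R),
        Δ ((osIdeal R L).ringCon.mk' x) =
          (parallelIdeal R r).ringCon.mk' (ExteriorAlgebra.map f x)) ∧
      (∀ i : Fin n,
        Δ ((osIdeal R L).ringCon.mk' (gen R n i)) =
          (parallelIdeal R r).ringCon.mk' (gen R (r + 1) (u i))) := by
  have mem_iff (i : Fin n) : i ∈ parClass L i₀ ↔ (L i₀).direction = (L i).direction := by
    simp [parClass, par_iff_direction_eq hline hdist]
  have map_gen (i : Fin n) : ExteriorAlgebra.map f (gen R n i) = gen R (r + 1) (u i) := by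
    simp [gen, hf]
  have eq_of_mem {i j : Fin n} {p : ℂ × ℂ} (hi : i ∈ parClass L i₀) (hj : j ∈ parClass L i₀)
      (hpi : p ∈ L i) (hpj : p ∈ L j) : i = j :=
    hdist (AffineSubspace.ext_of_direction_eq
      (((mem_iff i).1 hi).symm.trans ((mem_iff j).1 hj)) ⟨p, hpi, hpj⟩)
  have hgens : osGens R L ⊆ (parallelIdeal R r).comap (ExteriorAlgebra.map f) := by
    rintro x (⟨i, j, -, hdisj, rfl⟩ | ⟨i, j, k, hij, hik, hjk, ⟨p, ⟨hpi, hpj⟩, hpk⟩, rfl⟩)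
    · rw [SetLike.mem_coe, TwoSidedIdeal.mem_comap, map_mul, map_gen, map_gen]
      have hdir := (hline i).direction_eq_of_inter_eq_empty (hline j) hdisj
      by_cases hi : i ∈ parClass L i₀
      · exact gen_mul_gen_mem_parallelIdeal R (hu1 i hi)
          (hu1 j ((mem_iff j).2 (((mem_iff i).1 hi).trans hdir)))
      · have hj : j ∉ parClass L i₀ := fun hj =>
          hi ((mem_iff i).2 (((mem_iff j).1 hj).trans hdir.symm))
        rw [hu2 i hi, hu2 j hj, gen_mul_self]
        exact zero_mem _
    · rw [SetLike.mem_coe, TwoSidedIdeal.mem_comap]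
      simp only [map_add, map_sub, map_mul, map_gen]
      convert zero_mem (parallelIdeal R r) using 1
      have hsq := gen_mul_self R (r + 1) (Fin.last r)
      by_cases hi : i ∈ parClass L i₀
      · rw [hu2 j fun hj => hij (eq_of_mem hi hj hpi hpj),
          hu2 k fun hk => hik (eq_of_mem hi hk hpi hpk), hsq, sub_self, add_zero]
      · rw [hu2 i hi]
        by_cases hj : j ∈ parClass L i₀
        · rw [hu2 k fun hk => hjk (eq_of_mem hj hk hpj hpk), hsq, sub_zero,
            gen_mul_gen_add_swap]
        · rw [hu2 j hj, hsq, zero_sub, neg_add_cancel]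
  have hmap : ∀ x ∈ osIdeal R L, ExteriorAlgebra.map f x ∈ parallelIdeal R r := fun x hx =>
    (TwoSidedIdeal.mem_comap _).1 (TwoSidedIdeal.mem_span_iff.1 hx _ hgens)
  refine ⟨hmap, (osIdeal R L).ringCon.liftₐ
    (((parallelIdeal R r).ringCon.mkₐ R).comp (ExteriorAlgebra.map f)) ?_, fun x => rfl,
    fun i => congrArg _ (map_gen i)⟩
  intro x y hxy
  refine (RingCon.eq _).2 ?_
  rw [TwoSidedIdeal.rel_iff] at hxy ⊢
  simpa using hmap _ hxy
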